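/- arXiv:1310.3971 — 2 statements merged into one kernel-verified Lean document; each statement's English description precedes it below -/
import Mathlib

section
/- (Binary case of the monadic realizability property for starred functions.) Suppose merge : ε → ε → ε satisfies property (EX): if pext e₁ s and pext e₂ s then pext (merge e₁ e₂) s. Let f : α → β → T γ be such that for all a, b with P a and Q b, f a b monadically realizes R at s. Then for every m : T α monadically realizing P at s and every m' : T β monadically realizing Q at s, the term star₂ f m m' := star (fun z => f z.1 z.2) (mmerge m m') monadically realizes R at s. -/
/-- The state-exception monad: `T α = σ → α ⊕ ε`. -/
abbrev T (σ ε α : Type*) := σ → α ⊕ ε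

/-- Unit of the state-exception monad. -/
def eta {σ ε α : Type*} (a : α) : T σ ε α := fun _ => Sum.inl a

/-- Lifting (Kleisli star) of the state-exception monad. -/
def star {σ ε α β : Type*} (f : α → T σ ε β) (m : T σ ε α) : T σ ε β :=
  fun s => match m s with
  | Sum.inl a => f a s
  | Sum.inr e => Sum.inr e

/-- Merging operation of the state-exception monad. -/
def mmerge {σ ε α β : Type*} (merge : ε → ε → ε)
    (m : T σ ε α) (m' : T σ ε β) : T σ ε (α × β) :=
  fun s => match m s, m' s with
  | Sum.inl a, Sum.inl b => Sum.inl (a, b)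
  | Sum.inr e₁, Sum.inl _ => Sum.inr e₁
  | Sum.inl _, Sum.inr e₂ => Sum.inr e₂
  | Sum.inr e₁, Sum.inr e₂ => Sum.inr (merge e₁ e₂)

/-- `m` monadically realizes `P` at state `s`: either `m s` is a regular value
realizing `P`, or it is an exception properly extending `s`. -/
def MR {σ ε α : Type*} (pext : ε → σ → Prop) (s : σ) (P : α → Prop)
    (m : T σ ε α) : Prop :=
  (∃ a, m s = Sum.inl a ∧ P a) ∨ (∃ e, m s = Sum.inr e ∧ pext e s)

/-- Binary case of the monadic realizability property for starred functions. -/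
theorem MR_star2 {σ ε α β γ : Type*} (pext : ε → σ → Prop)
    (merge : ε → ε → ε)
    (hEX : ∀ (s : σ) (e₁ e₂ : ε), pext e₁ s → pext e₂ s → pext (merge e₁ e₂) s)
    (s : σ) (P : α → Prop) (Q : β → Prop) (R : γ → Prop)
    (f : α → β → T σ ε γ)
    (hf : ∀ a b, P a → Q b → MR pext s R (f a b))
    (m : T σ ε α) (m' : T σ ε β)
    (hm : MR pext s P m) (hm' : MR pext s Q m') :
    MR pext s R (star (fun z : α × β => f z.1 z.2) (mmerge merge m m')) := by
  rcases hm with ⟨a, ha, hP⟩ | ⟨e₁, he₁, hs₁⟩ <;>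
    rcases hm' with ⟨b, hb, hQ⟩ | ⟨e₂, he₂, hs₂⟩
  · have hstar : _root_.star (fun z : α × β => f z.1 z.2) (mmerge merge m m') s = f a b s := by
      simp only [_root_.star, mmerge, ha, hb]
    simpa only [MR, hstar] using hf a b hP hQ
  · exact Or.inr ⟨e₂, by simp only [_root_.star, mmerge, ha, he₂], hs₂⟩
  · exact Or.inr ⟨e₁, by simp only [_root_.star, mmerge, he₁, hb], hs₁⟩
  · exact Or.inr ⟨merge e₁ e₂, by simp only [_root_.star, mmerge, he₁, he₂], hEX s e₁ e₂ hs₁ hs₂⟩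
end

section
/- (Binary case of the monadic realizability property for raised functions.) Suppose merge : ε → ε → ε satisfies property (EX): if pext e₁ s and pext e₂ s then pext (merge e₁ e₂) s. Let f : α → β → γ be a pure function such that for all a, b with P a and Q b, R (f a b) holds. Then for every m : T α monadically realizing P at s and every m' : T β monadically realizing Q at s, the term raise₂ f m m' := star (fun z => η (f z.1 z.2)) (mmerge m m') monadically realizes R at s. -/
/-- If `f` sends realizers of `P` to monadic realizers of `R`, then so does its lifting on
monadic realizers of `P`. -/
theorem MR.star {σ ε α β : Type*} {pext : ε → σ → Prop} {s : σ} {P : α → Prop} {R : β → Prop}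
    {f : α → T σ ε β} {m : T σ ε α} (hm : MR pext s P m) (hf : ∀ a, P a → MR pext s R (f a)) :
    MR pext s R (_root_.star f m) := by
  rcases hm with ⟨a, ha, hPa⟩ | ⟨e, he, hext⟩
  · simpa [MR, _root_.star, ha] using hf a hPa
  · exact Or.inr ⟨e, by simp [_root_.star, he], hext⟩

/-- A regular value monadically realizes every predicate it satisfies. -/
theorem MR.eta {σ ε α : Type*} (pext : ε → σ → Prop) (s : σ) {P : α → Prop} {a : α} (ha : P a) :
    MR pext s P (_root_.eta a) :=
  Or.inl ⟨a, rfl, ha⟩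

/-- Merging monadic realizers yields a monadic realizer of the conjunction, provided merging
exceptions preserves proper extension of `s`. -/
theorem MR.mmerge {σ ε α β : Type*} {pext : ε → σ → Prop} {s : σ} {P : α → Prop} {Q : β → Prop}
    {merge : ε → ε → ε} (hEX : ∀ e₁ e₂, pext e₁ s → pext e₂ s → pext (merge e₁ e₂) s)
    {m : T σ ε α} {m' : T σ ε β} (hm : MR pext s P m) (hm' : MR pext s Q m') :
    MR pext s (fun z : α × β => P z.1 ∧ Q z.2) (_root_.mmerge merge m m') := by
  rcases hm with ⟨a, ha, hPa⟩ | ⟨e₁, he₁, hext₁⟩ <;>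
    rcases hm' with ⟨b, hb, hQb⟩ | ⟨e₂, he₂, hext₂⟩
  · exact Or.inl ⟨(a, b), by simp [_root_.mmerge, ha, hb], hPa, hQb⟩
  · exact Or.inr ⟨e₂, by simp [_root_.mmerge, ha, he₂], hext₂⟩
  · exact Or.inr ⟨e₁, by simp [_root_.mmerge, he₁, hb], hext₁⟩
  · exact Or.inr ⟨merge e₁ e₂, by simp [_root_.mmerge, he₁, he₂], hEX e₁ e₂ hext₁ hext₂⟩

/-- Binary case of the monadic realizability property for raised functions. -/
theorem MR_raise2 {σ ε α β γ : Type*} (pext : ε → σ → Prop)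
    (merge : ε → ε → ε)
    (hEX : ∀ (s : σ) (e₁ e₂ : ε), pext e₁ s → pext e₂ s → pext (merge e₁ e₂) s)
    (s : σ) (P : α → Prop) (Q : β → Prop) (R : γ → Prop)
    (f : α → β → γ)
    (hf : ∀ a b, P a → Q b → R (f a b))
    (m : T σ ε α) (m' : T σ ε β)
    (hm : MR pext s P m) (hm' : MR pext s Q m') :
    MR pext s R (star (fun z : α × β => eta (f z.1 z.2)) (mmerge merge m m')) :=
  (hm.mmerge (hEX s) hm').star fun z hz => MR.eta pext s (hf z.1 z.2 hz.1 hz.2)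
end
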